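/- arXiv:0708.3741 — 2 statements merged into one kernel-verified Lean document; each statement's English description precedes it below -/
import Mathlib

section
/- Let p be a prime, k a field of characteristic p, G = C_p × C_p × C_p, and let w be the p-dimensional kG-module k[C_p] on which the first two factors of G act trivially and the third factor acts by the regular representation of C_p (so w ≅ Ind_{C_p × C_p × 1}^G(k)). Then the class of w-projective kG-modules is not closed under directed colimits: there exists a sequence M_0 → M_1 → M_2 → ⋯ of w-projective kG-modules with kG-linear transition maps whose colimit M is not w-projective. -/
open CategoryTheory MonoidalCategory Limits

/-- `X` is `w`-projective: `X` is a direct summand of `w ⊗ Y` (diagonal `G`-action)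
for some `kG`-module `Y`. -/
def IsRelProjective {k G : Type} [Field k] [Group G] (w X : Rep k G) : Prop :=
  ∃ (Y : Rep k G) (i : X ⟶ w ⊗ Y) (r : w ⊗ Y ⟶ X), i ≫ r = 𝟙 X

/-- `f` factors through some `w`-projective module. -/
def FactorsThroughRelProj {k G : Type} [Field k] [Group G] (w : Rep k G)
    {X Y : Rep k G} (f : X ⟶ Y) : Prop :=
  ∃ (Z : Rep k G) (g : X ⟶ Z) (h : Z ⟶ Y), IsRelProjective w Z ∧ g ≫ h = f

/-- The cyclic group of order `p`. -/
abbrev CycGrp (p : ℕ) : Type := Multiplicative (ZMod p)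

/-- The group `G = C_p × C_p × C_p`. -/
abbrev CpCpCp (p : ℕ) : Type := CycGrp p × CycGrp p × CycGrp p

/-- The `p`-dimensional `kG`-module `k[C_p]` on which the first two factors of
`G = C_p × C_p × C_p` act trivially and the third acts via the regular representation
of `C_p`; i.e. `w ≅ Ind_{C_p × C_p × 1}^G (k)`. -/
noncomputable def wIndCpCp (p : ℕ) (k : Type) [Field k] : Rep k (CpCpCp p) :=
  Rep.of ((Representation.ofMulAction k (CycGrp p) (CycGrp p)).comp
    ((MonoidHom.snd (CycGrp p) (CycGrp p)).comp
      (MonoidHom.snd (CycGrp p) (CycGrp p × CycGrp p))))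


namespace RelProj

theorem IsRelProjective.exists_lift {k G : Type} [Field k] [Group G] {w : Rep k G}
    (δ : w ⟶ w ⊗ w) (ε : w ⟶ 𝟙_ (Rep k G)) (h : δ ≫ ε ▷ w ≫ (λ_ w).hom = 𝟙 w)
    {X L : Rep k G} (hX : IsRelProjective w X) (α : X ⟶ L) :
    ∃ β : X ⟶ w ⊗ L, β ≫ ε ▷ L ≫ (λ_ L).hom = α := by
  obtain ⟨Y, i, r, hir⟩ := hX
  refine ⟨i ≫ δ ▷ Y ≫ (α_ w w Y).hom ≫ w ◁ (r ≫ α), ?_⟩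
  have key : δ ▷ Y ≫ (α_ w w Y).hom ≫ ε ▷ (w ⊗ Y) ≫ (λ_ (w ⊗ Y)).hom = 𝟙 _ := by
    have := congrArg (· ▷ Y) h
    simpa using this
  calc _ = i ≫ (δ ▷ Y ≫ (α_ w w Y).hom ≫ ε ▷ (w ⊗ Y) ≫ (λ_ (w ⊗ Y)).hom) ≫ r ≫ α := by
        simp [whisker_exchange_assoc]
    _ = α := by rw [key, Category.id_comp, reassoc_of% hir]

theorem IsRelProjective.biprod_tensor {k G : Type} [Field k] [Group G] (w L L' : Rep k G) :
    IsRelProjective w ((w ⊗ L) ⊞ (w ⊗ L')) :=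
  ⟨L ⊞ L', biprod.desc (w ◁ biprod.inl) (w ◁ biprod.inr),
    biprod.lift (w ◁ biprod.fst) (w ◁ biprod.snd), by
      apply biprod.hom_ext' <;> apply biprod.hom_ext <;>
        simp [← MonoidalCategory.whiskerLeft_comp]⟩

section

variable (p : ℕ) (k : Type) [Field k]

theorem wIndCpCp_ρ_single (g : CpCpCp p) (c : CycGrp p) (a : k) :
    (wIndCpCp p k).ρ g (MonoidAlgebra.single c a) = MonoidAlgebra.single (g.2.2 * c) a := by
  have h : (wIndCpCp p k).ρ g = Representation.ofMulAction k (CycGrp p) (CycGrp p) g.2.2 := rfl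
  rw [h]
  exact Representation.ofMulAction_single g.2.2 c a

/-- The linear map on `k[C]` with prescribed values on group elements. -/
noncomputable def linOfBasis {C V : Type} [AddCommGroup V] [Module k V] (b : C → V) :
    MonoidAlgebra k C →ₗ[k] V :=
  Finsupp.linearCombination k b ∘ₗ (MonoidAlgebra.coeffLinearEquiv k).toLinearMap

theorem linOfBasis_single {C V : Type} [AddCommGroup V] [Module k V] (b : C → V) (c : C) (a : k) :
    linOfBasis k b (MonoidAlgebra.single c a) = a • b c := by
  simp [linOfBasis]

variable {p k}

/-- The morphism out of `wIndCpCp p k` with prescribed values on group elements. -/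
noncomputable def wHom {X : Rep k (CpCpCp p)} (b : CycGrp p → X.V)
    (hb : ∀ g c, b (g.2.2 * c) = X.ρ g (b c)) : wIndCpCp p k ⟶ X :=
  Rep.ofHom ⟨linOfBasis k b, fun g => by
    refine MonoidAlgebra.lhom_ext' fun c => LinearMap.ext_ring ?_
    have := wIndCpCp_ρ_single p k g c 1
    simp only [wIndCpCp] at this
    simp [linOfBasis_single, hb]⟩

theorem wHom_single {X : Rep k (CpCpCp p)} (b : CycGrp p → X.V)
    (hb : ∀ g c, b (g.2.2 * c) = X.ρ g (b c)) (c : CycGrp p) (a : k) :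
    (wHom b hb).hom (MonoidAlgebra.single c a) = a • b c :=
  linOfBasis_single ..

variable (p k)

/-- The augmentation `k[C] ⟶ k`. -/
noncomputable def wCounit : wIndCpCp p k ⟶ 𝟙_ (Rep k (CpCpCp p)) :=
  wHom (X := Rep.trivial k (CpCpCp p) k) (fun _ => (1 : k)) fun _ _ => by simp

theorem wCounit_single (c : CycGrp p) (a : k) :
    (wCounit p k).hom (MonoidAlgebra.single c a : MonoidAlgebra k (CycGrp p)) = a :=
  (wHom_single (X := Rep.trivial k (CpCpCp p) k) _ _ c a).trans (mul_one a)

/-- The diagonal map `k[C] ⟶ k[C] ⊗ k[C]`. -/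
noncomputable def wComul : wIndCpCp p k ⟶ wIndCpCp p k ⊗ wIndCpCp p k :=
  wHom (fun c => (TensorProduct.tmul k (MonoidAlgebra.single c (1 : k) : (wIndCpCp p k).V)
    (MonoidAlgebra.single c (1 : k) : (wIndCpCp p k).V))) fun g c => by
    rw [Rep.tensor_ρ, Representation.tprod_apply]
    erw [TensorProduct.map_tmul]
    rw [wIndCpCp_ρ_single]

/-- Multiplication by `t - 1` on `k[C]`, for the generator `t` of `C`, as a linear map. -/
noncomputable def shiftLin : MonoidAlgebra k (CycGrp p) →ₗ[k] MonoidAlgebra k (CycGrp p) :=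
  linOfBasis k fun c => MonoidAlgebra.single (Multiplicative.ofAdd 1 * c) (1 : k) -
    MonoidAlgebra.single c (1 : k)

theorem shiftLin_single (c : CycGrp p) (a : k) :
    shiftLin p k (MonoidAlgebra.single c a) =
      MonoidAlgebra.single (Multiplicative.ofAdd 1 * c) a - MonoidAlgebra.single c a := by
  rw [shiftLin, linOfBasis_single, smul_sub, MonoidAlgebra.smul_single, MonoidAlgebra.smul_single,
    smul_eq_mul, mul_one]

/-- Multiplication by `t - 1` on `k[C]`, for the generator `t` of `C`. -/
noncomputable def wShift : wIndCpCp p k ⟶ wIndCpCp p k :=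
  wHom (fun c => (MonoidAlgebra.single (Multiplicative.ofAdd 1 * c) (1 : k) -
    MonoidAlgebra.single c (1 : k) : MonoidAlgebra k (CycGrp p))) fun g c => by
    refine Eq.trans ?_ (map_sub ((wIndCpCp p k).ρ g) _ _).symm
    rw [wIndCpCp_ρ_single, wIndCpCp_ρ_single, mul_left_comm]
    rfl

variable {p k} in
theorem wInd_hom_ext {X : Rep k (CpCpCp p)} {f g : wIndCpCp p k ⟶ X}
    (h : ∀ c, f.hom (MonoidAlgebra.single c (1 : k) : MonoidAlgebra k (CycGrp p)) =
      g.hom (MonoidAlgebra.single c (1 : k) : MonoidAlgebra k (CycGrp p))) : f = g := by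
  apply Rep.hom_ext
  apply Representation.IntertwiningMap.toLinearMap_injective
  exact MonoidAlgebra.lhom_ext' fun c => LinearMap.ext_ring (h c)

theorem wComul_counit :
    wComul p k ≫ wCounit p k ▷ wIndCpCp p k ≫ (λ_ (wIndCpCp p k)).hom = 𝟙 _ := by
  apply wInd_hom_ext
  intro c
  rw [Rep.hom_comp, Rep.hom_comp]
  change (λ_ (wIndCpCp p k)).hom.hom ((wCounit p k ▷ wIndCpCp p k).hom ((wComul p k).hom _)) = _
  rw [wComul, wHom_single, one_smul]
  refine Eq.trans (congrArg (fun a : k => a •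
    (MonoidAlgebra.single c (1 : k) : MonoidAlgebra k (CycGrp p))) (wCounit_single p k c 1)) ?_
  exact one_smul _ _

theorem wShift_counit : wShift p k ≫ wCounit p k = 0 := by
  apply wInd_hom_ext
  intro c
  refine (congrArg (wCounit p k).hom (shiftLin_single p k c 1)).trans ?_
  refine (map_sub (wCounit p k).hom _ _).trans ?_
  exact (congrArg₂ (fun a b : k => a - b) (wCounit_single ..) (wCounit_single ..)).trans
    (sub_self _)

/-- An element of `k[C]` which `t - 1` sends to the norm element. -/
noncomputable def normPreimage [NeZero p] [CharP k p] : MonoidAlgebra k (CycGrp p) :=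
  ∑ i : ZMod p, MonoidAlgebra.single (Multiplicative.ofAdd i) (-ZMod.castHom (dvd_refl p) k i)

theorem shiftLin_normPreimage [NeZero p] [CharP k p] :
    shiftLin p k (normPreimage p k) =
      ∑ i : ZMod p, MonoidAlgebra.single (Multiplicative.ofAdd i) (1 : k) := by
  have h : ∀ i : ZMod p, shiftLin p k (MonoidAlgebra.single (Multiplicative.ofAdd i)
        (-ZMod.castHom (dvd_refl p) k i)) =
      MonoidAlgebra.single (Multiplicative.ofAdd (1 + i)) (1 - ZMod.castHom (dvd_refl p) k (1 + i))
        - MonoidAlgebra.single (Multiplicative.ofAdd i) (-ZMod.castHom (dvd_refl p) k i) := by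
    intro i
    rw [shiftLin_single, ofAdd_add, map_add (ZMod.castHom _ k), map_one (ZMod.castHom _ k),
      sub_add_cancel_left]
  rw [normPreimage, map_sum, Finset.sum_congr rfl fun i _ => h i,
    Finset.sum_sub_distrib, Fintype.sum_equiv (Equiv.addLeft (1 : ZMod p))
      (fun i => MonoidAlgebra.single (Multiplicative.ofAdd (1 + i))
        (1 - ZMod.castHom (dvd_refl p) k (1 + i))) (fun i =>
    (MonoidAlgebra.single (Multiplicative.ofAdd i) (1 - ZMod.castHom (dvd_refl p) k i) :
      MonoidAlgebra k (CycGrp p))) fun i => rfl, ← Finset.sum_sub_distrib]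
  refine Finset.sum_congr rfl fun i _ => ?_
  rw [← MonoidAlgebra.single_sub, sub_neg_eq_add, sub_add_cancel]

/-- The coefficient of the identity element. -/
noncomputable def coeffOne : MonoidAlgebra k (CycGrp p) →ₗ[k] k :=
  Finsupp.lapply 1 ∘ₗ (MonoidAlgebra.coeffLinearEquiv k).toLinearMap

theorem coeffOne_single (c : CycGrp p) (a : k) :
    coeffOne p k (MonoidAlgebra.single c a) = if c = 1 then a else 0 := by
  simp [coeffOne, Finsupp.single_apply]

variable {p k}

/-- The linear map `w ⊗ L → L` taking the coefficient of the identity element of `C`. -/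
noncomputable def slice (L : Rep k (CpCpCp p)) : (wIndCpCp p k ⊗ L : Rep k (CpCpCp p)) →ₗ[k] L :=
  (TensorProduct.lid k L.V).toLinearMap ∘ₗ LinearMap.rTensor L.V (coeffOne p k)

/-- The pure tensor `u ⊗ l` as an element of the module `w ⊗ L`. -/
noncomputable def tmul {L : Rep k (CpCpCp p)} (u : MonoidAlgebra k (CycGrp p)) (l : L) :
    (wIndCpCp p k ⊗ L : Rep k (CpCpCp p)) :=
  TensorProduct.tmul k (M := MonoidAlgebra k (CycGrp p)) u l

theorem slice_tmul {L : Rep k (CpCpCp p)} (u : MonoidAlgebra k (CycGrp p)) (l : L) :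
    slice L (tmul u l) = coeffOne p k u • l := rfl

theorem ρ_tmul_single {L : Rep k (CpCpCp p)} (g : CpCpCp p) (c : CycGrp p) (a : k) (l : L) :
    (wIndCpCp p k ⊗ L : Rep k (CpCpCp p)).ρ g (tmul (MonoidAlgebra.single c a) l) =
      tmul (MonoidAlgebra.single (g.2.2 * c) a) (L.ρ g l) :=
  congrArg (fun u => tmul (L := L) u (L.ρ g l)) (wIndCpCp_ρ_single p k g c a)

theorem tensor_lhom_ext {L : Rep k (CpCpCp p)} {V : Type} [AddCommGroup V] [Module k V]
    {f g : (wIndCpCp p k ⊗ L : Rep k (CpCpCp p)) →ₗ[k] V}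
    (h : ∀ c (l : L), f (tmul (MonoidAlgebra.single c 1) l) =
      g (tmul (MonoidAlgebra.single c 1) l)) : f = g := by
  apply TensorProduct.ext
  refine MonoidAlgebra.lhom_ext' (M := CycGrp p) fun c => LinearMap.ext_ring ?_
  exact LinearMap.ext fun l => h c l

theorem slice_ρ {L : Rep k (CpCpCp p)} (g : CpCpCp p) (hg : g.2.2 = 1)
    (m : (wIndCpCp p k ⊗ L : Rep k (CpCpCp p))) :
    slice L ((wIndCpCp p k ⊗ L : Rep k (CpCpCp p)).ρ g m) = L.ρ g (slice L m) := by
  suffices h : slice L ∘ₗ (wIndCpCp p k ⊗ L : Rep k (CpCpCp p)).ρ g = L.ρ g ∘ₗ slice L from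
    LinearMap.congr_fun h m
  refine tensor_lhom_ext fun c l => ?_
  rw [LinearMap.comp_apply, LinearMap.comp_apply, ρ_tmul_single, slice_tmul, slice_tmul, hg,
    one_mul, map_smul]

theorem ρ_tmul {L : Rep k (CpCpCp p)} (g : CpCpCp p) (hg : g.2.2 = 1)
    (u : MonoidAlgebra k (CycGrp p)) (l : L) :
    (wIndCpCp p k ⊗ L : Rep k (CpCpCp p)).ρ g (tmul u l) = tmul u (L.ρ g l) := by
  have h : (wIndCpCp p k).ρ g = LinearMap.id := by
    refine MonoidAlgebra.lhom_ext' (M := CycGrp p) fun c => LinearMap.ext_ring ?_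
    refine (wIndCpCp_ρ_single p k g c 1).trans ?_
    rw [hg, one_mul]
    rfl
  exact congrArg (fun u => tmul (L := L) u (L.ρ g l)) (LinearMap.congr_fun h u)

/-- The morphism `w ⊗ L ⟶ L` induced by the augmentation. -/
noncomputable def aug (L : Rep k (CpCpCp p)) : wIndCpCp p k ⊗ L ⟶ L :=
  wCounit p k ▷ L ≫ (λ_ L).hom

theorem aug_tmul_single {L : Rep k (CpCpCp p)} (c : CycGrp p) (a : k) (l : L) :
    (aug L).hom (tmul (MonoidAlgebra.single c a) l) = a • l :=
  congrArg (fun a : k => a • l) (wCounit_single p k c a)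

theorem sum_slice_ρ [NeZero p] {L : Rep k (CpCpCp p)} (hL : ∀ c, L.ρ (1, 1, c) = LinearMap.id)
    (m : (wIndCpCp p k ⊗ L : Rep k (CpCpCp p))) :
    ∑ i : ZMod p, slice L ((wIndCpCp p k ⊗ L : Rep k (CpCpCp p)).ρ
      (1, 1, Multiplicative.ofAdd i) m) = (aug L).hom m := by
  suffices h : ∑ i : ZMod p, slice L ∘ₗ (wIndCpCp p k ⊗ L : Rep k (CpCpCp p)).ρ
      (1, 1, Multiplicative.ofAdd i) = (aug L).hom.toLinearMap by
    have := LinearMap.congr_fun h m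
    rwa [LinearMap.sum_apply] at this
  refine tensor_lhom_ext fun c l => ?_
  rw [LinearMap.sum_apply]
  refine Eq.trans ?_ (aug_tmul_single c 1 l).symm
  rw [Fintype.sum_eq_single (-c.toAdd)]
  · rw [LinearMap.comp_apply, ρ_tmul_single, slice_tmul, coeffOne_single, hL, if_pos]
    · rfl
    · simp
  · intro i hi
    rw [LinearMap.comp_apply, ρ_tmul_single, slice_tmul, coeffOne_single, if_neg, zero_smul]
    intro h
    exact hi (eq_neg_of_add_eq_zero_left (congrArg Multiplicative.toAdd h))

/-- A morphism `a` lifting the augmentation recovers every `l` from the norm element. -/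
theorem slice_hom_norm [NeZero p] {L : Rep k (CpCpCp p)} (hL : ∀ c, L.ρ (1, 1, c) = LinearMap.id)
    (a : wIndCpCp p k ⊗ L ⟶ wIndCpCp p k ⊗ L) (ha : a ≫ aug L = aug L) (l : L) :
    slice L (a.hom (tmul (∑ i : ZMod p, MonoidAlgebra.single (Multiplicative.ofAdd i) (1 : k)) l)) =
      l := by
  have h1 : (tmul (∑ i : ZMod p, MonoidAlgebra.single (Multiplicative.ofAdd i) (1 : k)) l :
      (wIndCpCp p k ⊗ L : Rep k (CpCpCp p))) = ∑ i : ZMod p,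
        (wIndCpCp p k ⊗ L : Rep k (CpCpCp p)).ρ (1, 1, Multiplicative.ofAdd i)
          (tmul (MonoidAlgebra.single 1 1) l) := by
    refine (TensorProduct.sum_tmul _ _ _).trans (Finset.sum_congr rfl fun i _ => ?_)
    rw [ρ_tmul_single, hL, mul_one]
    rfl
  rw [h1, map_sum, map_sum]
  simp_rw [Rep.hom_comm_apply]
  rw [sum_slice_ρ hL, ← Rep.comp_apply, ha, aug_tmul_single, one_smul]

/-- The transition map of the sequence whose colimit is not `w`-projective. -/
noncomputable def transition {L : Rep k (CpCpCp p)} (ζ : L ⟶ L) :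
    (wIndCpCp p k ⊗ L) ⊞ (wIndCpCp p k ⊗ L) ⟶ (wIndCpCp p k ⊗ L) ⊞ (wIndCpCp p k ⊗ L) :=
  biprod.desc biprod.inl (biprod.lift (wShift p k ▷ L) (wIndCpCp p k ◁ ζ))

theorem inl_transition {L : Rep k (CpCpCp p)} (ζ : L ⟶ L) :
    biprod.inl ≫ transition ζ = biprod.inl :=
  biprod.inl_desc _ _

theorem inr_transition {L : Rep k (CpCpCp p)} (ζ : L ⟶ L) :
    biprod.inr ≫ transition ζ =
      wShift p k ▷ L ≫ biprod.inl + (wIndCpCp p k ◁ ζ) ≫ biprod.inr :=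
  (biprod.inr_desc _ _).trans biprod.lift_eq

theorem transition_comp_desc_aug {L : Rep k (CpCpCp p)} (ζ : L ⟶ L) :
    transition ζ ≫ biprod.desc (aug L) 0 = biprod.desc (aug L) 0 := by
  apply biprod.hom_ext'
  · simp [transition]
  · simp only [transition, biprod.inr_desc_assoc, biprod.lift_desc, biprod.inr_desc, aug, comp_zero,
      add_zero]
    rw [← comp_whiskerRight_assoc, wShift_counit]
    simp

variable [CharP k p]

theorem exists_compatible [NeZero p] {L : Rep k (CpCpCp p)} (hL : ∀ c, L.ρ (1, 1, c) = LinearMap.id)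
    (ζ : L ⟶ L) (a : wIndCpCp p k ⊗ L ⟶ wIndCpCp p k ⊗ L) (ha : a ≫ aug L = aug L)
    (b : ℕ → (wIndCpCp p k ⊗ L ⟶ wIndCpCp p k ⊗ L))
    (hb : ∀ n, b n = wShift p k ▷ L ≫ a + wIndCpCp p k ◁ ζ ≫ b (n + 1)) :
    ∃ ψ : ℕ → L →ₗ[k] L, (∀ n l, ψ n l = l + ψ (n + 1) (ζ.hom l)) ∧
      ∀ n (g : CpCpCp p) l, g.2.2 = 1 → ψ n (L.ρ g l) = L.ρ g (ψ n l) := by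
  refine ⟨fun n => slice L ∘ₗ (b n).hom.toLinearMap ∘ₗ
    TensorProduct.mk k (MonoidAlgebra k (CycGrp p)) L (normPreimage p k), fun n l => ?_,
    fun n g l hg => ?_⟩
  · have h1 : (wShift p k ▷ L).hom (tmul (normPreimage p k) l) =
        tmul (∑ i : ZMod p, MonoidAlgebra.single (Multiplicative.ofAdd i) (1 : k)) l :=
      congrArg (fun u => tmul (L := L) u l) (shiftLin_normPreimage p k)
    have h2 : (b n).hom (tmul (normPreimage p k) l) =
        a.hom ((wShift p k ▷ L).hom (tmul (normPreimage p k) l)) +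
          (b (n + 1)).hom (tmul (normPreimage p k) (ζ.hom l)) := by
      rw [hb n]; rfl
    change slice L ((b n).hom (tmul (normPreimage p k) l)) =
      l + slice L ((b (n + 1)).hom (tmul (normPreimage p k) (ζ.hom l)))
    rw [h2, h1, map_add, slice_hom_norm hL a ha]
  · change slice L ((b n).hom (tmul (normPreimage p k) (L.ρ g l))) =
      L.ρ g (slice L ((b n).hom (tmul (normPreimage p k) l)))
    rw [← ρ_tmul g hg, Rep.hom_comm_apply, slice_ρ g hg]

variable (p k)

/-- The polynomial by which a group element acts from the top to the bottom of the
Kronecker module. -/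
noncomputable def kronPoly (g : CpCpCp p) : Polynomial k :=
  Polynomial.C (ZMod.castHom (dvd_refl p) k g.1.toAdd) +
    Polynomial.C (ZMod.castHom (dvd_refl p) k g.2.1.toAdd) * Polynomial.X

theorem kronPoly_mul (g h : CpCpCp p) : kronPoly p k (g * h) = kronPoly p k g + kronPoly p k h := by
  simp only [kronPoly, Prod.fst_mul, Prod.snd_mul, toAdd_mul, map_add]
  ring

/-- The Kronecker module `k[X] ⇉ k[X]` with arrows `1` and `X`, as a representation: the first
two generators of `G` act as `1` plus these arrows, the third acts trivially. -/
noncomputable def kron : Representation k (CpCpCp p) (Polynomial k × Polynomial k) where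
  toFun g := LinearMap.id + LinearMap.inr k _ _ ∘ₗ LinearMap.mulLeft k (kronPoly p k g) ∘ₗ
    LinearMap.fst k _ _
  map_one' := by
    ext : 1 <;> ext <;> simp [kronPoly]
  map_mul' g h := by
    refine LinearMap.ext fun v => Prod.ext ?_ ?_
    · simp
    · simp [kronPoly_mul]
      ring

theorem kron_apply (g : CpCpCp p) (v : Polynomial k × Polynomial k) :
    kron p k g v = (v.1, v.2 + kronPoly p k g * v.1) := by
  simp [kron, Prod.ext_iff]

/-- Multiplication by `X` on the Kronecker module. -/
noncomputable def kronX : Rep.of (kron p k) ⟶ Rep.of (kron p k) :=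
  Rep.ofHom ⟨LinearMap.prodMap (LinearMap.mulLeft k Polynomial.X)
    (LinearMap.mulLeft k Polynomial.X), fun g => by
      refine LinearMap.ext fun v => ?_
      simp only [LinearMap.comp_apply, kron_apply, LinearMap.prodMap_apply, LinearMap.mulLeft_apply]
      refine Prod.ext rfl ?_
      ring⟩

theorem kronX_apply (v : Polynomial k × Polynomial k) :
    (kronX p k).hom v = (Polynomial.X * v.1, Polynomial.X * v.2) := rfl

theorem not_exists_compatible :
    ¬ ∃ ψ : ℕ → (Polynomial k × Polynomial k) →ₗ[k] (Polynomial k × Polynomial k),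
      (∀ n l, ψ n l = l + ψ (n + 1) ((kronX p k).hom l)) ∧
      ∀ n (g : CpCpCp p) l, g.2.2 = 1 → ψ n (kron p k g l) = kron p k g (ψ n l) := by
  rintro ⟨ψ, h1, h2⟩
  have hX : ∀ n, (ψ n (Polynomial.X, 0)).1 = Polynomial.X * (ψ n (1, 0)).1 := by
    intro n
    have ha := h2 n (Multiplicative.ofAdd 1, 1, 1) (Polynomial.X, 0) rfl
    have hb := h2 n (1, Multiplicative.ofAdd 1, 1) (1, 0) rfl
    have hs : ∀ u v : Polynomial k, ψ n (u, v) = ψ n (u, 0) + ψ n (0, v) := by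
      intro u v
      rw [← map_add]
      simp
    rw [kron_apply, kron_apply, hs] at ha hb
    have ha2 := congrArg Prod.snd ha
    have hb2 := congrArg Prod.snd hb
    simp [kronPoly] at ha2 hb2
    rw [← ha2, hb2]
  have hP : ∀ n, (ψ n (1, 0)).1 = 1 + Polynomial.X * (ψ (n + 1) (1, 0)).1 := by
    intro n
    rw [h1 n, kronX_apply, ← hX]
    simp
  have hc : ∀ i n, (ψ n (1, 0)).1.coeff i = 1 := by
    intro i
    induction i with
    | zero => intro n; rw [hP]; simp
    | succ i ih => intro n; rw [hP]; simp [Polynomial.coeff_one, ih]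
  have := hc ((ψ 0 (1, 0)).1.natDegree + 1) 0
  rw [Polynomial.coeff_eq_zero_of_natDegree_lt (Nat.lt_succ_self _)] at this
  exact zero_ne_one this

/-- The colimit of a sequence of copies of one endomorphism `f`, as an object with compatible
maps from the source of `f` through which every `f`-invariant morphism factors. -/
theorem exists_colimit_maps {C : Type*} [Category C] {M : C} (f : M ⟶ M)
    [HasColimit (Functor.ofSequence (X := fun _ => M) fun _ => f)] :
    ∃ ι : ℕ → (M ⟶ colimit (Functor.ofSequence (X := fun _ => M) fun _ => f)),
      (∀ n, f ≫ ι (n + 1) = ι n) ∧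
      ∀ {X : C} (α : M ⟶ X), f ≫ α = α → ∃ α', ∀ n, ι n ≫ α' = α := by
  let F := Functor.ofSequence (X := fun _ : ℕ => M) fun _ => f
  refine ⟨fun n => colimit.ι F n, fun n => ?_, fun {X} α h => ?_⟩
  · have := colimit.w F (homOfLE (Nat.le_succ n))
    rwa [Functor.ofSequence_map_homOfLE_succ] at this
  · let τ : F ⟶ (Functor.const ℕ).obj X := NatTrans.ofSequence (fun _ => α) fun n => by
      rw [Functor.ofSequence_map_homOfLE_succ]
      exact h.trans (Category.comp_id α).symm
    exact ⟨colimit.desc F ⟨X, τ⟩, fun n => colimit.ι_desc _ _⟩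

theorem not_isRelProjective_colimit [NeZero p] :
    ¬ IsRelProjective (wIndCpCp p k) (colimit (Functor.ofSequence
      (X := fun _ => (wIndCpCp p k ⊗ Rep.of (kron p k)) ⊞ (wIndCpCp p k ⊗ Rep.of (kron p k)))
      fun _ => transition (kronX p k))) := by
  intro hM
  obtain ⟨ι, hι, hdesc⟩ := exists_colimit_maps (transition (kronX p k))
  obtain ⟨α, hα⟩ := hdesc _ (transition_comp_desc_aug (kronX p k))
  obtain ⟨β, hβ⟩ := IsRelProjective.exists_lift (wComul p k) (wCounit p k) (wComul_counit p k) hM α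
  have hinl : ∀ n, biprod.inl ≫ ι n ≫ β = biprod.inl ≫ ι 0 ≫ β := by
    intro n
    induction n with
    | zero => rfl
    | succ n ih =>
      rw [← ih, ← hι n, Category.assoc, ← Category.assoc biprod.inl (transition _), inl_transition]
  refine not_exists_compatible p k (exists_compatible (L := Rep.of (kron p k)) ?_ (kronX p k)
    (biprod.inl ≫ ι 0 ≫ β) ?_ (fun n => biprod.inr ≫ ι n ≫ β) fun n => ?_)
  · intro c
    refine LinearMap.ext fun v => (kron_apply p k _ v).trans ?_
    simp [kronPoly]
  · rw [Category.assoc, Category.assoc, aug, hβ, hα, biprod.inl_desc, aug]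
  · rw [← hinl (n + 1), ← hι n]
    rw [Category.assoc, ← Category.assoc, inr_transition, Preadditive.add_comp, Category.assoc,
      Category.assoc]

end

end RelProj

/-- For `G = C_p × C_p × C_p` and `w = Ind_{C_p × C_p × 1}^G (k)`, the class of
`w`-projective modules is not closed under directed colimits: there is a sequence
`M₀ → M₁ → ⋯` of `w`-projective modules whose colimit is not `w`-projective. -/
theorem relProjective_not_closed_under_colimits (p : ℕ) (hp : p.Prime)
    (k : Type) [Field k] [CharP k p] :
    ∃ (M : ℕ → Rep k (CpCpCp p)) (f : ∀ n, M n ⟶ M (n + 1)),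
      (∀ n, IsRelProjective (wIndCpCp p k) (M n)) ∧
      ¬ IsRelProjective (wIndCpCp p k) (colimit (Functor.ofSequence f)) := by
  have : NeZero p := ⟨hp.ne_zero⟩
  exact ⟨_, _, fun _ => RelProj.IsRelProjective.biprod_tensor _ _ _,
    RelProj.not_isRelProjective_colimit p k⟩
end

section
/- Let k be a field of characteristic 2, G = C2 × C2 = ⟨g⟩ × ⟨h⟩, and let w be the 2-dimensional kG-module on which g acts trivially and h acts by the regular representation of C2. If X is a finite-dimensional indecomposable kG-module whose socle contains at least two copies of the trivial module k (i.e., dim_k Hom_{kG}(k, X) ≥ 2), then Hom_w(k, X) ≠ 0; that is, there is a kG-homomorphism k → X which does not factor through any w-projective module. -/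
open CategoryTheory MonoidalCategory Limits

/-- The cyclic group of order 2. -/
abbrev CycTwo : Type := Multiplicative (ZMod 2)

/-- The Klein four group `G = C2 × C2 = ⟨g⟩ × ⟨h⟩`. -/
abbrev KleinFour : Type := CycTwo × CycTwo

/-- The 2-dimensional `kG`-module `k[C2]` on which the first factor `⟨g⟩` of the Klein
four group acts trivially and the second factor `⟨h⟩` acts by the regular
representation of `C2`; i.e. `w ≅ Ind_{⟨g⟩×1}^G (k)`. -/
noncomputable def wKlein (k : Type) [Field k] : Rep k KleinFour :=
  Rep.of ((Representation.ofMulAction k CycTwo CycTwo).comp (MonoidHom.snd CycTwo CycTwo))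

/-- A vector outside a subspace is separated from it by a functional normalised to take the
value `1` there. -/
theorem Submodule.exists_dual_eq_one_of_notMem {k V : Type*} [Field k] [AddCommGroup V]
    [Module k V] {p : Submodule k V} {x : V} (hx : x ∉ p) :
    ∃ γ : Module.Dual k V, γ x = 1 ∧ ∀ y ∈ p, γ y = 0 := by
  obtain ⟨f, hf, hp⟩ := p.exists_le_ker_of_notMem hx
  exact ⟨(f x)⁻¹ • f, by simp [hf], fun y hy => by simp [LinearMap.mem_ker.mp (hp hy)]⟩

/-- Let `u`, `v` be commuting square-zero endomorphisms such that `ker u ∩ ker v = v (ker u)`.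
Then a nonzero space carries a nonzero idempotent commuting with `u` and `v` whose restriction
to `ker u ∩ ker v` has rank at most one. -/
theorem exists_commuting_idempotent {k V : Type*} [Field k] [AddCommGroup V]
    [Module k V] [Nontrivial V] (u v : V →ₗ[k] V) (huu : ∀ x, u (u x) = 0)
    (hvv : ∀ x, v (v x) = 0) (huv : ∀ x, v (u x) = u (v x))
    (hS : ∀ x, u x = 0 → v x = 0 → ∃ y, u y = 0 ∧ v y = x) :
    ∃ (e : V →ₗ[k] V) (γ : Module.Dual k V) (t : V), (∀ z, e (u z) = u (e z)) ∧
      (∀ z, e (v z) = v (e z)) ∧ (∀ z, e (e z) = e z) ∧ e ≠ 0 ∧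
      ∀ z, u z = 0 → v z = 0 → e z = γ z • t := by
  by_cases hc : ∃ x, u (v x) ≠ 0
  · obtain ⟨x, hx⟩ := hc
    have hmem : u (v x) ∉ Submodule.span k {x, u x, v x} := by
      rw [Submodule.mem_span_triple]
      rintro ⟨a, b, c, h⟩
      have h1 := congrArg (fun z => u (v z)) h
      simp only [map_add, map_smul, huv, huu, hvv, map_zero, smul_zero, add_zero, smul_eq_zero,
        hx, or_false] at h1
      have h2 := congrArg v h
      simp only [h1, map_add, map_smul, huv, hvv, map_zero, smul_zero, add_zero, zero_smul,
        zero_add, smul_eq_zero, hx, or_false] at h2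
      have h3 := congrArg u h
      simp only [h1, h2, map_smul, huu, zero_smul,
        zero_add, smul_eq_zero, hx, or_false] at h3
      exact hx (by simpa [h1, h2, h3] using h.symm)
    obtain ⟨γ, h1, h0⟩ := Submodule.exists_dual_eq_one_of_notMem hmem
    have hx0 : γ x = 0 := h0 _ (Submodule.subset_span (by simp))
    have hu0 : γ (u x) = 0 := h0 _ (Submodule.subset_span (by simp))
    have hv0 : γ (v x) = 0 := h0 _ (Submodule.subset_span (by simp))
    refine ⟨(γ ∘ₗ u ∘ₗ v).smulRight x + (γ ∘ₗ v).smulRight (u x) + (γ ∘ₗ u).smulRight (v x)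
      + γ.smulRight (u (v x)), γ, u (v x), ?_, ?_, ?_, ?_, ?_⟩
    · intro z; simp [huu, huv]
    · intro z; simp [huv, hvv]
    · intro z; simp [huu, huv, hvv, h1, hx0, hu0, hv0]
    · intro h
      have := congrArg (fun f => γ (f (u (v x)))) h
      simp [huu, huv, hvv, h1] at this
    · intro z hu hv
      simp [hu, hv]
  push Not at hc
  by_cases hu : ∃ x, u x ≠ 0
  · obtain ⟨x', hx'⟩ := hu
    obtain ⟨y, huy, hvy⟩ := hS (u x') (huu _) (by rw [huv, hc])
    obtain ⟨x₁, hux₁, hvx₁⟩ := hS (v x') (hc _) (hvv _)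
    obtain ⟨x, hux, hvx⟩ : ∃ x, u x = u x' ∧ v x = 0 := ⟨x' - x₁, by simp [hux₁], by simp [hvx₁]⟩
    set t := u x' with ht
    have hut : u t = 0 := huu _
    have hvt : v t = 0 := by rw [ht, huv, hc]
    have hmem : t ∉ Submodule.span k {x, y} := by
      rw [Submodule.mem_span_pair]
      rintro ⟨a, b, h⟩
      have h1 := congrArg u h
      simp only [map_add, map_smul, hux, huy, hut, smul_zero, add_zero, smul_eq_zero, hx',
        or_false] at h1
      have h2 := congrArg v h
      simp only [h1, map_smul, hvy, hvt, zero_smul, zero_add, smul_eq_zero,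
        hx', or_false] at h2
      exact hx' (by simpa [h1, h2] using h.symm)
    obtain ⟨γ, h1, h0⟩ := Submodule.exists_dual_eq_one_of_notMem hmem
    have hx0 : γ x = 0 := h0 _ (Submodule.subset_span (by simp))
    have hy0 : γ y = 0 := h0 _ (Submodule.subset_span (by simp))
    refine ⟨(γ ∘ₗ u).smulRight x + (γ ∘ₗ v).smulRight y + γ.smulRight t, γ, t, ?_, ?_, ?_, ?_, ?_⟩
    · intro z; simp [huu, huv, hc, hux, huy, hut]
    · intro z; simp [hc, hvv, hvx, hvy, hvt]
    · intro z; simp [hux, huy, hut, hvx, hvy, hvt, h1, hx0, hy0]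
    · intro h
      have := congrArg (fun f => γ (f t)) h
      simp [hut, hvt, h1] at this
    · intro z hu hv
      simp [hu, hv]
  push Not at hu
  obtain ⟨x, hx⟩ := exists_ne (0 : V)
  obtain ⟨y, hvy⟩ : ∃ y, v y ≠ 0 := by
    by_contra! h
    obtain ⟨y, -, hy⟩ := hS x (hu x) (h x)
    exact hx (hy ▸ h y)
  have hmem : v y ∉ Submodule.span k {y} := by
    rw [Submodule.mem_span_singleton]
    rintro ⟨a, h⟩
    have h1 := congrArg v h
    simp only [map_smul, hvv, smul_eq_zero, hvy, or_false] at h1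
    exact hvy (by simpa [h1] using h.symm)
  obtain ⟨γ, h1, h0⟩ := Submodule.exists_dual_eq_one_of_notMem hmem
  have hy0 : γ y = 0 := h0 _ (Submodule.subset_span (by simp))
  refine ⟨(γ ∘ₗ v).smulRight y + γ.smulRight (v y), γ, v y, ?_, ?_, ?_, ?_, ?_⟩
  · intro z; simp [hu]
  · intro z; simp [hvv]
  · intro z; simp [hvv, h1, hy0]
  · intro h
    have := congrArg (fun f => γ (f (v y))) h
    simp [hvv, h1] at this
  · intro z _ hv
    simp [hv]

/-- In an idempotent complete preadditive category, the only idempotent endomorphisms of an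
object without nontrivial binary direct sum decompositions are zero and the identity. -/
theorem eq_zero_or_eq_id_of_idem {C : Type*} [Category C] [Preadditive C]
    [HasBinaryBiproducts C] [IsIdempotentComplete C] {X : C}
    (hind : ∀ A B : C, (X ≅ A ⊞ B) → IsZero A ∨ IsZero B) (e : X ⟶ X) (he : e ≫ e = e) :
    e = 0 ∨ e = 𝟙 X := by
  obtain ⟨A, i, r, hir, hri⟩ := IsIdempotentComplete.idempotents_split X e he
  obtain ⟨B, j, s, hjs, hsj⟩ := IsIdempotentComplete.idempotents_split X (𝟙 X - e)
    (by simp [he])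
  have his : i ≫ s = 0 := by
    have h : i ≫ s = (i ≫ r) ≫ i ≫ s ≫ j ≫ s := by rw [hjs, hir]; simp
    rw [h, Category.assoc, reassoc_of% hri, reassoc_of% hsj]
    simp [reassoc_of% he]
  have hjr : j ≫ r = 0 := by
    have h : j ≫ r = (j ≫ s) ≫ j ≫ r ≫ i ≫ r := by rw [hjs, hir]; simp
    rw [h, Category.assoc, reassoc_of% hsj, reassoc_of% hri]
    simp [reassoc_of% he]
  rcases hind A B
    { hom := biprod.lift r s
      inv := biprod.desc i j
      hom_inv_id := by simp [hri, hsj]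
      inv_hom_id := by ext <;> simp [hir, hjs, his, hjr] } with hA | hB
  · exact Or.inl (by rw [← hri, hA.eq_of_tgt r 0, zero_comp])
  · refine Or.inr (sub_eq_zero.mp ?_).symm
    rw [← hsj, hB.eq_of_tgt s 0, zero_comp]

/-- The projection of `k[C2]` onto the line spanned by the identity of `C2`. -/
noncomputable def projOne (k : Type) [Field k] :
    MonoidAlgebra k CycTwo →ₗ[k] MonoidAlgebra k CycTwo :=
  (MonoidAlgebra.coeffLinearEquiv k).symm.toLinearMap ∘ₗ Finsupp.lsingle 1 ∘ₗ Finsupp.lapply 1 ∘ₗ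
    (MonoidAlgebra.coeffLinearEquiv k).toLinearMap

theorem projOne_single (k : Type) [Field k] (a : CycTwo) (c : k) :
    projOne k (MonoidAlgebra.single a c) = if a = 1 then MonoidAlgebra.single a c else 0 := by
  split_ifs with h
  · subst h; simp [projOne]
  · simp [projOne, h]

theorem cyc_cases (a : CycTwo) : a = 1 ∨ a = Multiplicative.ofAdd 1 := by
  revert a; decide

/-- A vector of `w ⊗ Y` fixed by the Klein four group is the relative trace of a vector fixed
by the first factor. -/
theorem exists_trace_of_tprod_fixed {k : Type} [Field k] {V : Type*} [AddCommGroup V] [Module k V]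
    (σ : Representation k KleinFour V) (z : TensorProduct k (MonoidAlgebra k CycTwo) V)
    (hz : ∀ x, (wKlein k).ρ.tprod σ x z = z) :
    ∃ y, (wKlein k).ρ.tprod σ (Multiplicative.ofAdd 1, 1) y = y ∧
      z = y + (wKlein k).ρ.tprod σ (1, Multiplicative.ofAdd 1) y := by
  set T : Representation k KleinFour (TensorProduct k (MonoidAlgebra k CycTwo) V) :=
    (wKlein k).ρ.tprod σ
  let Q : TensorProduct k (MonoidAlgebra k CycTwo) V →ₗ[k]
    TensorProduct k (MonoidAlgebra k CycTwo) V := (projOne k).rTensor V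
  have hTz (x : KleinFour) : T x z = z := hz x
  have hw (x : KleinFour) (a : CycTwo) (c : k) : (wKlein k).ρ x (MonoidAlgebra.single a c) =
      MonoidAlgebra.single (x.2 * a) c :=
    Representation.ofMulAction_single x.2 a c
  have hTs (x : KleinFour) (a : CycTwo) (c : k) (v : V) : T x (MonoidAlgebra.single a c ⊗ₜ v) =
      MonoidAlgebra.single (x.2 * a) c ⊗ₜ σ x v :=
    congrArg (fun m : MonoidAlgebra k CycTwo => m ⊗ₜ[k] σ x v) (hw x a c)
  have hQs (a : CycTwo) (c : k) (v : V) : Q (MonoidAlgebra.single a c ⊗ₜ v) =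
      if a = 1 then MonoidAlgebra.single a c ⊗ₜ v else 0 := by
    change projOne k _ ⊗ₜ v = _
    rw [projOne_single]
    split_ifs <;> simp
  have hext {f f' : TensorProduct k (MonoidAlgebra k CycTwo) V →ₗ[k]
      TensorProduct k (MonoidAlgebra k CycTwo) V}
      (h : ∀ a c v, f (MonoidAlgebra.single a c ⊗ₜ v) = f' (MonoidAlgebra.single a c ⊗ₜ v)) :
      f = f' := by
    refine TensorProduct.ext' fun x y => ?_
    induction x using MonoidAlgebra.induction_linear with
    | zero => simp
    | add x x' hx hx' => simp [TensorProduct.add_tmul, hx, hx']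
    | single a c => exact h a c y
  have hQg : T (Multiplicative.ofAdd 1, 1) ∘ₗ Q = Q ∘ₗ T (Multiplicative.ofAdd 1, 1) := by
    refine hext fun a c v => ?_
    simp only [LinearMap.comp_apply, hTs, hQs, one_mul]
    split_ifs <;> simp [hTs]
  have hQh : Q + T (1, Multiplicative.ofAdd 1) ∘ₗ Q ∘ₗ T (1, Multiplicative.ofAdd 1) =
      LinearMap.id := by
    have hhh : T (1, Multiplicative.ofAdd 1) * T (1, Multiplicative.ofAdd 1) = 1 := by
      rw [← map_mul, ← map_one T]
      exact congrArg T (by decide)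
    refine hext fun a c v => ?_
    have h1 := LinearMap.congr_fun hhh (MonoidAlgebra.single a c ⊗ₜ v)
    rw [Module.End.mul_apply, Module.End.one_apply, hTs] at h1
    simp only [LinearMap.add_apply, LinearMap.comp_apply, LinearMap.id_apply]
    rw [hTs, hQs, hQs]
    rcases cyc_cases a with rfl | rfl
    · rw [if_pos rfl, if_neg (by decide), map_zero, add_zero]
    · rw [if_neg (by decide), if_pos (by decide), h1, zero_add]
  refine ⟨Q z, ?_, ?_⟩
  · have h := LinearMap.congr_fun hQg z
    rwa [LinearMap.comp_apply, LinearMap.comp_apply, hTz] at h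
  · have h := LinearMap.congr_fun hQh z
    rw [LinearMap.add_apply, LinearMap.comp_apply, LinearMap.comp_apply, hTz] at h
    exact h.symm

/-- A homomorphism from `k` that factors through a `w`-projective module picks out a relative
trace from `⟨g⟩` of a `⟨g⟩`-fixed vector. -/
theorem FactorsThroughRelProj.exists_trace {k : Type} [Field k] {X : Rep k KleinFour}
    {f : Rep.trivial k KleinFour k ⟶ X} (hf : FactorsThroughRelProj (wKlein k) f) :
    ∃ y : X.V, X.ρ (Multiplicative.ofAdd 1, 1) y = y ∧
      f.hom (1 : k) = y + X.ρ (1, Multiplicative.ofAdd 1) y := by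
  obtain ⟨Z, a, b, ⟨Y, i, r, hir⟩, rfl⟩ := hf
  obtain ⟨y, hy, hzy⟩ := exists_trace_of_tprod_fixed Y.ρ ((a ≫ i).hom (1 : k)) fun x =>
    (Rep.hom_comm_apply (a ≫ i) x (1 : k)).symm
  have hcomm (x : KleinFour) : X.ρ x ((r ≫ b).hom y) =
      (r ≫ b).hom ((wKlein k ⊗ Y).ρ x y) := (Rep.hom_comm_apply (r ≫ b) x y).symm
  refine ⟨(r ≫ b).hom y, ?_, ?_⟩
  · exact (hcomm _).trans (congrArg (r ≫ b).hom hy)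
  · have hab : a ≫ b = (a ≫ i) ≫ r ≫ b := by rw [Category.assoc, reassoc_of% hir]
    rw [hab, hcomm]
    exact (congrArg (r ≫ b).hom hzy).trans (map_add (r ≫ b).hom _ _)

/-- Over the Klein four group in characteristic 2, with `w = Ind_{⟨g⟩×1}^G(k)`: if `X`
is a finite-dimensional indecomposable module whose socle contains at least two copies
of the trivial module (`dim_k Hom_{kG}(k, X) ≥ 2`), then `Hom_w(k, X) ≠ 0`: some
`kG`-homomorphism `k → X` does not factor through any `w`-projective module. -/
theorem trivial_detects_klein (k : Type) [Field k] [CharP k 2]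
    (X : Rep k KleinFour) [FiniteDimensional k X.V]
    (hne : ¬ IsZero X)
    (hind : ∀ (A B : Rep k KleinFour), (X ≅ A ⊞ B) → IsZero A ∨ IsZero B)
    (hsocle : 2 ≤ Module.finrank k (Rep.trivial k KleinFour k ⟶ X)) :
    ∃ f : Rep.trivial k KleinFour k ⟶ X,
      ¬ FactorsThroughRelProj (wKlein k) f := by
  by_contra! hall
  have hnt : Nontrivial X.V := by
    rwa [Rep.isZero_iff, not_subsingleton_iff_nontrivial] at hne
  let gg : KleinFour := (Multiplicative.ofAdd 1, 1)
  let hh : KleinFour := (1, Multiplicative.ofAdd 1)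
  have hinv (x : KleinFour) (z : X.V) : X.ρ x (X.ρ x z) = z := by
    rw [← Module.End.mul_apply, ← map_mul, show x * x = 1 by revert x; decide, map_one,
      Module.End.one_apply]
  have hgh (z : X.V) : X.ρ hh (X.ρ gg z) = X.ρ gg (X.ρ hh z) := by
    rw [← Module.End.mul_apply, ← Module.End.mul_apply, ← map_mul, ← map_mul, mul_comm]
  have htwo (z : X.V) : z + z = 0 := by
    rw [← two_smul k z, CharTwo.two_eq_zero (R := k), zero_smul]
  have hsq (x : KleinFour) (z : X.V) : (X.ρ x + 1) ((X.ρ x + 1) z) = 0 := by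
    simp only [LinearMap.add_apply, Module.End.one_apply, map_add, hinv]
    rw [add_comm (X.ρ x z), htwo]
  have hker (x : KleinFour) (z : X.V) : (X.ρ x + 1) z = 0 ↔ X.ρ x z = z := by
    rw [LinearMap.add_apply, Module.End.one_apply, ← eq_neg_iff_add_eq_zero,
      ← eq_neg_of_add_eq_zero_left (htwo z)]
  have hcases (x : KleinFour) : x = 1 ∨ x = gg ∨ x = hh ∨ x = gg * hh := by
    revert x; decide
  have hfix (z : X.V) (hg : X.ρ gg z = z) (hh' : X.ρ hh z = z) (x : KleinFour) :
      X.ρ x z = z := by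
    rcases hcases x with rfl | rfl | rfl | rfl
    · simp
    · exact hg
    · exact hh'
    · rw [map_mul, Module.End.mul_apply, hh', hg]
  obtain ⟨e, γ, t, heu, hev, hee, he0, hes⟩ := exists_commuting_idempotent (X.ρ gg + 1)
    (X.ρ hh + 1) (hsq gg) (hsq hh) (fun z => by simp [hgh]; abel) (by
      intro z hg hh'
      rw [hker] at hg hh'
      let f : Rep.trivial k KleinFour k ⟶ X := Rep.ofHom
        ⟨LinearMap.toSpanSingleton k X.V z, fun x => by ext; simp [hfix z hg hh' x]⟩
      obtain ⟨y, hy, hzy⟩ := (hall f).exists_trace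
      refine ⟨y, (hker _ _).2 hy, ?_⟩
      rw [LinearMap.add_apply, Module.End.one_apply, add_comm, ← hzy]
      exact one_smul k z)
  have hecomm (x : KleinFour) (z : X.V) : e (X.ρ x z) = X.ρ x (e z) := by
    have heg (z : X.V) : e (X.ρ gg z) = X.ρ gg (e z) := by simpa using heu z
    have heh (z : X.V) : e (X.ρ hh z) = X.ρ hh (e z) := by simpa using hev z
    rcases hcases x with rfl | rfl | rfl | rfl
    · simp
    · exact heg z
    · exact heh z
    · rw [map_mul, Module.End.mul_apply, Module.End.mul_apply, heg, heh]
  let E : X ⟶ X := Rep.ofHom ⟨e, fun x => LinearMap.ext (hecomm x)⟩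
  have hE (z : X.V) : E.hom z = e z := rfl
  have hEE : E ≫ E = E := by
    ext z
    exact hee z
  rcases eq_zero_or_eq_id_of_idem hind E hEE with h0 | h1
  · exact he0 (LinearMap.ext fun z => by rw [← hE, h0]; rfl)
  · let Φ : (Rep.trivial k KleinFour k ⟶ X) →ₗ[k] k :=
      { toFun f := γ (f.hom (1 : k))
        map_add' f f' := map_add γ _ _
        map_smul' c f := map_smul γ c _ }
    have : FiniteDimensional k (Rep.trivial k KleinFour k ⟶ X) :=
      FiniteDimensional.of_finrank_pos (by omega)
    obtain ⟨f, hf, hf0⟩ := Submodule.exists_mem_ne_zero_of_ne_bot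
      (LinearMap.ker_ne_bot_of_finrank_lt (f := Φ) (by rw [Module.finrank_self]; omega))
    have hfx (x : KleinFour) : X.ρ x (f.hom (1 : k)) = f.hom (1 : k) :=
      (Rep.hom_comm_apply f x (1 : k)).symm
    have hf1 : f.hom (1 : k) = 0 := by
      have h := hes (f.hom (1 : k)) ((hker _ _).2 (hfx gg)) ((hker _ _).2 (hfx hh))
      rw [← hE, h1, show γ (f.hom (1 : k)) = 0 from hf, zero_smul] at h
      exact h
    apply hf0
    ext
    exact hf1
end
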